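/- For all reducibility candidates R and S of λ-terms, the set R → S := { t | for every u ∈ R, app t u ∈ S } is a reducibility candidate. -/

import Mathlib

/-- Untyped λ-terms with de Bruijn indices. -/
inductive Tm : Type
  | var : ℕ → Tm
  | app : Tm → Tm → Tm
  | lam : Tm → Tm
deriving DecidableEq

namespace Tm

/-- Lifting (shifting) of de Bruijn indices at cutoff `d`. -/
def lift (d : ℕ) : Tm → Tm
  | var n => if n < d then var n else var (n + 1)
  | app t u => app (lift d t) (lift d u)
  | lam t => lam (lift (d + 1) t)

/-- Capture-avoiding substitution: `subst t k s` substitutes `s` for the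
variable `k` in `t` (decrementing the free variables above `k`). -/
def subst : Tm → ℕ → Tm → Tm
  | var n, k, s => if n = k then s else if k < n then var (n - 1) else var n
  | app t u, k, s => app (subst t k s) (subst u k s)
  | lam t, k, s => lam (subst t (k + 1) (lift 0 s))

/-- One-step β-reduction: congruence closure of the root rule
`app (lam t) u → t[0 := u]`. -/
inductive Beta : Tm → Tm → Prop
  | beta (t u : Tm) : Beta (app (lam t) u) (subst t 0 u)
  | appL {t t' : Tm} (u : Tm) : Beta t t' → Beta (app t u) (app t' u)
  | appR (t : Tm) {u u' : Tm} : Beta u u' → Beta (app t u) (app t u')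
  | lam {t t' : Tm} : Beta t t' → Beta (lam t) (lam t')

/-- A term is strongly normalizing if it is accessible under β-reduction. -/
def SN (t : Tm) : Prop := Acc (fun a b => Beta b a) t

end Tm

open Tm

/-- A term is neutral iff it is not an abstraction. -/
def Neutral (t : Tm) : Prop := ∀ t₀ : Tm, t ≠ lam t₀

/-- A reducibility candidate: (R1) contained in SN, (R2) stable by reduction,
(R3) contains every neutral term all of whose one-step reducts it contains. -/
def IsCand (R : Set Tm) : Prop :=
  (∀ t ∈ R, SN t) ∧
  (∀ t ∈ R, ∀ t', Beta t t' → t' ∈ R) ∧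
  (∀ t, Neutral t → (∀ t', Beta t t' → t' ∈ R) → t ∈ R)

/-- The function part of a strongly normalizing application is strongly normalizing. -/
theorem Tm.SN.of_app {t u : Tm} (h : SN (app t u)) : SN t := by
  generalize hs : app t u = s at h
  induction h generalizing t with
  | intro s _ ih =>
    subst hs
    exact Acc.intro _ fun t' ht => ih _ (Beta.appL u ht) rfl

/-- Every candidate contains the variables. -/
theorem IsCand.var_mem {R : Set Tm} (hR : IsCand R) (n : ℕ) : var n ∈ R :=
  hR.2.2 _ (fun _ h => nomatch h) fun _ h => nomatch h

/-- The arrow construction on reducibility candidates yields a reducibility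
candidate. -/
theorem arrow_isCand (R S : Set Tm) (hR : IsCand R) (hS : IsCand S) :
    IsCand {t | ∀ u ∈ R, app t u ∈ S} := by
  refine ⟨fun t ht => (hS.1 _ (ht _ (hR.var_mem 0))).of_app,
    fun t ht t' h u hu => hS.2.1 _ (ht u hu) _ (Beta.appL u h), ?_⟩
  intro t hn ht u hu
  have hu_sn : SN u := hR.1 u hu
  induction hu_sn with
  | intro u _ ih =>
    refine hS.2.2 _ (fun _ h => nomatch h) fun s hs => ?_
    cases hs with
    | beta t₀ => exact absurd rfl (hn t₀)
    | appL _ h => exact ht _ h u hu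
    | appR _ h => exact ih _ h (hR.2.1 u hu _ h)
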